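/- arXiv:0902.0130 — 2 statements merged into one kernel-verified Lean document; each statement's English description precedes it below -/
import Mathlib

section
/- For the KKM potential V_II, each of the five integrals is in involution with the Hamiltonian: {H,A₁} = {H,A₂} = {H,B₁} = {H,B₂} = {H,F} = 0. -/
noncomputable section

open MvPolynomial

/-- The field of rational functions over ℂ in the six variables
`x, y, z, p_x, p_y, p_z`: the fraction field of the polynomial ring. -/
abbrev K6 : Type := FractionRing (MvPolynomial (Fin 6) ℂ)

/-- The canonical embedding of the polynomial ring into its fraction field. -/
def toK6 : MvPolynomial (Fin 6) ℂ →+* K6 :=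
  algebraMap (MvPolynomial (Fin 6) ℂ) K6

/-- Constants, embedded in `K6`. -/
def cC (a : ℂ) : K6 := toK6 (MvPolynomial.C a)

/-- The imaginary unit `i`, embedded in `K6`. -/
def iC : K6 := cC Complex.I

def vx : K6 := toK6 (MvPolynomial.X 0)
def vy : K6 := toK6 (MvPolynomial.X 1)
def vz : K6 := toK6 (MvPolynomial.X 2)
def vpx : K6 := toK6 (MvPolynomial.X 3)
def vpy : K6 := toK6 (MvPolynomial.X 4)
def vpz : K6 := toK6 (MvPolynomial.X 5)

/-- `D` is the (unique) extension to the fraction field of the formal partial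
derivative `pderiv j` on the polynomial ring: an additive map satisfying the
Leibniz rule which agrees with `pderiv j` on polynomials. -/
def IsPDeriv (j : Fin 6) (D : K6 → K6) : Prop :=
  (∀ f g : K6, D (f + g) = D f + D g) ∧
  (∀ f g : K6, D (f * g) = D f * g + f * D g) ∧
  (∀ p, D (toK6 p) = toK6 (pderiv j p))

/-- The canonical Poisson bracket on `K6`, where `Pd 0, …, Pd 5` are the
partial derivatives with respect to `x, y, z, p_x, p_y, p_z` respectively:
`{f,g} = f_x g_{p_x} + f_y g_{p_y} + f_z g_{p_z}
  - f_{p_x} g_x - f_{p_y} g_y - f_{p_z} g_z`. -/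
def poisson (Pd : Fin 6 → K6 → K6) (f g : K6) : K6 :=
  Pd 0 f * Pd 3 g + Pd 1 f * Pd 4 g + Pd 2 f * Pd 5 g
    - Pd 3 f * Pd 0 g - Pd 4 f * Pd 1 g - Pd 5 f * Pd 2 g

/-- Angular momentum `J_x = y p_z - z p_y`. -/
def Jx : K6 := vy * vpz - vz * vpy
/-- Angular momentum `J_y = z p_x - x p_z`. -/
def Jy : K6 := vz * vpx - vx * vpz
/-- Angular momentum `J_z = x p_y - y p_x`. -/
def Jz : K6 := vx * vpy - vy * vpx
/-- Total angular momentum squared `J² = J_x² + J_y² + J_z²`. -/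
def Jsq : K6 := Jx ^ 2 + Jy ^ 2 + Jz ^ 2

/-- KKM V_II Hamiltonian. -/
def HV (α β γ δ : ℂ) : K6 :=
  vpx ^ 2 + vpy ^ 2 + vpz ^ 2 + cC α * (vx ^ 2 + vy ^ 2 + vz ^ 2)
    + cC β * (vx - iC * vy) / (vx + iC * vy) ^ 3
    + cC γ / (vx + iC * vy) ^ 2 + cC δ / vz ^ 2

def A1V (α δ : ℂ) : K6 := vpz ^ 2 + cC α * vz ^ 2 + cC δ / vz ^ 2

def A2V (β γ : ℂ) : K6 :=
  Jz ^ 2 + 2 * iC * vx * vy * (cC γ - 2 * cC β) / (vx + iC * vy) ^ 2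
    + 2 * cC γ * vx ^ 2 / (vx + iC * vy) ^ 2

def B1V (β γ δ : ℂ) : K6 :=
  Jsq
    + (vz ^ 2 * (cC β * (4 * vx * vy * (vy - iC * vx) + vz ^ 2 * (vx - iC * vy))
        + cC γ * (vx + iC * vy) * (2 * vx * (vx + iC * vy) + vz ^ 2))
      + cC δ * (vx - iC * vy) * (vx + iC * vy) ^ 4)
      / (vz ^ 2 * (vx + iC * vy) ^ 3)

def B2V (α β : ℂ) : K6 :=
  (vpx + iC * vpy) ^ 2 + cC α * (vx + iC * vy) ^ 2 - cC β / (vx + iC * vy) ^ 2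

def FV (β δ : ℂ) : K6 :=
  (Jy - iC * Jx) ^ 2
    + (cC δ * (vx + iC * vy) ^ 4 - cC β * vz ^ 4) / (vz ^ 2 * (vx + iC * vy) ^ 2)

theorem Derivation.map_ofNat {R A M : Type*} [CommSemiring R] [CommSemiring A] [Algebra R A]
    [AddCommMonoid M] [IsCancelAdd M] [Module A M] [Module R M] (D : Derivation R A M)
    (n : ℕ) [n.AtLeastTwo] : D (ofNat(n) : A) = 0 :=
  D.map_natCast n

/-- The Hamiltonian vector field `{f, ·}` of the canonical bracket built from six derivations. -/
def hamiltonianDerivation {K : Type*} [Field K] [Algebra ℂ K] (D : Fin 6 → Derivation ℂ K K)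
    (f : K) : Derivation ℂ K K :=
  D 0 f • D 3 + D 1 f • D 4 + D 2 f • D 5 - D 3 f • D 0 - D 4 f • D 1 - D 5 f • D 2

/-- The equations of motion of `HV` in the isotropic coordinates `s = x + iy`, `w = x - iy`, with
`P = p_x + i p_y`, `Q = p_x - i p_y`. -/
structure IsFlow {K : Type*} [Field K] [Algebra ℂ K] (V : Derivation ℂ K K)
    (a b g d s w z P Q r : K) : Prop where
  map_a : V a = 0
  map_b : V b = 0
  map_g : V g = 0
  map_d : V d = 0
  map_s : V s = -2 * P
  map_w : V w = -2 * Q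
  map_z : V z = -2 * r
  map_P : V P = 2 * (a * s + b / s ^ 3)
  map_Q : V Q = 2 * (a * w - 3 * b * w / s ^ 4 - 2 * g / s ^ 3)
  map_r : V r = 2 * (a * z - d / z ^ 3)

theorem derivation_hamiltonian {K : Type*} [Field K] [Algebra ℂ K] (D : Derivation ℂ K K)
    {a b g d i x y z : K} (p q r : K) (hs : x + i * y ≠ 0) (hz : z ≠ 0)
    (ha : D a = 0) (hb : D b = 0) (hg : D g = 0) (hd : D d = 0) (hi : D i = 0) :
    D (p ^ 2 + q ^ 2 + r ^ 2 + a * (x ^ 2 + y ^ 2 + z ^ 2)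
      + b * (x - i * y) / (x + i * y) ^ 3 + g / (x + i * y) ^ 2 + d / z ^ 2) =
    2 * (p * D p + q * D q + r * D r + a * (x * D x + y * D y + z * D z))
      + b * (D x - i * D y) / (x + i * y) ^ 3
      - (3 * b * (x - i * y) / (x + i * y) ^ 4 + 2 * g / (x + i * y) ^ 3) * (D x + i * D y)
      - 2 * d / z ^ 3 * D z := by
  have hDs : D (x + i * y) = D x + i * D y := by simp [hi]
  have hDw : D (x - i * y) = D x - i * D y := by simp [hi]
  generalize x + i * y = s at *
  generalize x - i * y = w at *
  simp only [map_add, Derivation.leibniz, Derivation.leibniz_div, Derivation.leibniz_pow, ha, hb,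
    hg, hd, hDs, hDw, smul_eq_mul, nsmul_eq_mul, mul_zero, add_zero, zero_sub]
  field_simp
  push_cast
  ring

theorem isFlow_hamiltonianDerivation {K : Type*} [Field K] [Algebra ℂ K]
    (D : Fin 6 → Derivation ℂ K K) (a b g d i x y z p q r : K)
    (hi : i ^ 2 = -1) (hs : x + i * y ≠ 0) (hz : z ≠ 0)
    (hc : ∀ j, D j a = 0 ∧ D j b = 0 ∧ D j g = 0 ∧ D j d = 0 ∧ D j i = 0)
    (hD : ∀ j k, D j (![x, y, z, p, q, r] k) = if k = j then 1 else 0) :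
    IsFlow (hamiltonianDerivation D (p ^ 2 + q ^ 2 + r ^ 2 + a * (x ^ 2 + y ^ 2 + z ^ 2)
      + b * (x - i * y) / (x + i * y) ^ 3 + g / (x + i * y) ^ 2 + d / z ^ 2)) a b g d
      (x + i * y) (x - i * y) z (p + i * q) (p - i * q) r := by
  have hx : ∀ j, D j x = if 0 = j then 1 else 0 := fun j => hD j 0
  have hy : ∀ j, D j y = if 1 = j then 1 else 0 := fun j => hD j 1
  have hz' : ∀ j, D j z = if 2 = j then 1 else 0 := fun j => hD j 2
  have hp : ∀ j, D j p = if 3 = j then 1 else 0 := fun j => hD j 3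
  have hq : ∀ j, D j q = if 4 = j then 1 else 0 := fun j => hD j 4
  have hr : ∀ j, D j r = if 5 = j then 1 else 0 := fun j => hD j 5
  have hH j := derivation_hamiltonian (D j) p q r hs hz (hc j).1 (hc j).2.1 (hc j).2.2.1
    (hc j).2.2.2.1 (hc j).2.2.2.2
  generalize p ^ 2 + q ^ 2 + r ^ 2 + a * (x ^ 2 + y ^ 2 + z ^ 2)
    + b * (x - i * y) / (x + i * y) ^ 3 + g / (x + i * y) ^ 2 + d / z ^ 2 = H at *
  have h0 : D 0 H = 2 * a * x + b / (x + i * y) ^ 3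
      - (3 * b * (x - i * y) / (x + i * y) ^ 4 + 2 * g / (x + i * y) ^ 3) := by
    simp [hH, hx, hy, hz', hp, hq, hr, mul_assoc]
  have h1 : D 1 H = 2 * a * y - i * (b / (x + i * y) ^ 3)
      - i * (3 * b * (x - i * y) / (x + i * y) ^ 4 + 2 * g / (x + i * y) ^ 3) := by
    simp [hH, hx, hy, hz', hp, hq, hr]
    ring
  have h2 : D 2 H = 2 * a * z - 2 * d / z ^ 3 := by
    simp [hH, hx, hy, hz', hp, hq, hr, mul_assoc]
  have h3 : D 3 H = 2 * p := by simp [hH, hx, hy, hz', hp, hq, hr]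
  have h4 : D 4 H = 2 * q := by simp [hH, hx, hy, hz', hp, hq, hr]
  have h5 : D 5 H = 2 * r := by simp [hH, hx, hy, hz', hp, hq, hr]
  have hV (f : K) : hamiltonianDerivation D H f = D 0 H * D 3 f + D 1 H * D 4 f + D 2 H * D 5 f
      - D 3 H * D 0 f - D 4 H * D 1 f - D 5 H * D 2 f := by
    simp [hamiltonianDerivation]
  have hVi : hamiltonianDerivation D H i = 0 := by simp [hV, hc]
  have hVx : hamiltonianDerivation D H x = -2 * p := by simp [hV, hx, h3]
  have hVy : hamiltonianDerivation D H y = -2 * q := by simp [hV, hy, h4]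
  have hVz : hamiltonianDerivation D H z = -2 * r := by simp [hV, hz', h5]
  have hVp : hamiltonianDerivation D H p = D 0 H := by simp [hV, hp]
  have hVq : hamiltonianDerivation D H q = D 1 H := by simp [hV, hq]
  have hVr : hamiltonianDerivation D H r = D 2 H := by simp [hV, hr]
  constructor
  · simp [hV, hc]
  · simp [hV, hc]
  · simp [hV, hc]
  · simp [hV, hc]
  · simp only [map_add, Derivation.leibniz, hVi, hVx, hVy, smul_eq_mul]
    ring
  · simp only [map_sub, Derivation.leibniz, hVi, hVx, hVy, smul_eq_mul]
    ring
  · exact hVz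
  · simp only [map_add, Derivation.leibniz, hVi, hVp, hVq, smul_eq_mul, h0, h1]
    linear_combination (-(b / (x + i * y) ^ 3)
      - (3 * b * (x - i * y) / (x + i * y) ^ 4 + 2 * g / (x + i * y) ^ 3)) * hi
  · simp only [map_sub, Derivation.leibniz, hVi, hVp, hVq, smul_eq_mul, h0, h1]
    linear_combination ((b / (x + i * y) ^ 3)
      + (3 * b * (x - i * y) / (x + i * y) ^ 4 + 2 * g / (x + i * y) ^ 3)) * hi
  · rw [hVr, h2]
    ring

namespace IsFlow

variable {K : Type*} [Field K] [Algebra ℂ K] {V : Derivation ℂ K K} {a b g d s w z P Q r : K}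

theorem map_separated (h : IsFlow V a b g d s w z P Q r) (hz : z ≠ 0) :
    V (r ^ 2 + a * z ^ 2 + d / z ^ 2) = 0 := by
  simp [Derivation.leibniz_div, Derivation.leibniz_pow, h.map_a, h.map_d, h.map_z, h.map_r]
  field_simp
  ring

theorem map_planar_angular (h : IsFlow V a b g d s w z P Q r) (hs : s ≠ 0) :
    V (-(w * P - s * Q) ^ 2 + 2 * (g - 2 * b) * (s ^ 2 - w ^ 2) / s ^ 2
      + 2 * g * (s + w) ^ 2 / s ^ 2) = 0 := by
  simp [Derivation.leibniz_div, Derivation.leibniz_pow, Derivation.map_ofNat, h.map_b, h.map_g,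
    h.map_s, h.map_w, h.map_P, h.map_Q]
  field_simp
  ring

theorem map_angular (h : IsFlow V a b g d s w z P Q r) (hs : s ≠ 0) (hz : z ≠ 0) :
    V (4 * (z * P - s * r) * (z * Q - w * r) - (w * P - s * Q) ^ 2
      + 4 * (z ^ 2 * (b * (z ^ 2 * w - (s ^ 2 - w ^ 2) * s)
        + g * s * ((s + w) * s + z ^ 2)) + d * w * s ^ 4) / (z ^ 2 * s ^ 3)) = 0 := by
  simp [Derivation.leibniz_div, Derivation.leibniz_pow, Derivation.map_ofNat, h.map_b, h.map_g,
    h.map_d, h.map_s, h.map_w, h.map_z, h.map_P, h.map_Q, h.map_r]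
  field_simp
  ring

theorem map_null_momentum (h : IsFlow V a b g d s w z P Q r) (hs : s ≠ 0) :
    V (P ^ 2 + a * s ^ 2 - b / s ^ 2) = 0 := by
  simp [Derivation.leibniz_div, Derivation.leibniz_pow, h.map_a, h.map_b, h.map_s, h.map_P]
  field_simp
  ring

theorem map_null_angular (h : IsFlow V a b g d s w z P Q r) (hs : s ≠ 0) (hz : z ≠ 0) :
    V ((z * P - s * r) ^ 2 + (d * s ^ 4 - b * z ^ 4) / (z ^ 2 * s ^ 2)) = 0 := by
  simp [Derivation.leibniz_div, Derivation.leibniz_pow, h.map_b, h.map_d, h.map_s, h.map_z,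
    h.map_P, h.map_r]
  field_simp
  ring

end IsFlow

namespace IsPDeriv

variable {j : Fin 6} {D : K6 → K6}

theorem map_cC (h : IsPDeriv j D) (a : ℂ) : D (cC a) = 0 := by
  simp [cC, h.2.2]

/-- A partial derivative on `K6`, bundled as a derivation. -/
def toDerivation (h : IsPDeriv j D) : Derivation ℂ K6 K6 :=
  Derivation.mk'
    { toFun := D
      map_add' := h.1
      map_smul' := fun c f => by
        have hc (f : K6) : c • f = cC c * f := Algebra.smul_def c f
        simp only [hc, h.2.1, h.map_cC, RingHom.id_apply, zero_mul, zero_add] }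
    fun f g => (h.2.1 f g).trans (by simp only [LinearMap.coe_mk, AddHom.coe_mk, smul_eq_mul]; ring)

@[simp]
theorem toDerivation_apply (h : IsPDeriv j D) (f : K6) : h.toDerivation f = D f := rfl

theorem map_toK6_X (h : IsPDeriv j D) (k : Fin 6) :
    D (toK6 (X k)) = if k = j then 1 else 0 := by
  rw [h.2.2, pderiv_X, Pi.single_apply]
  split_ifs <;> simp

end IsPDeriv

theorem iC_sq : iC ^ 2 = -1 := by
  simp [iC, cC, ← map_pow, Complex.I_sq]

theorem vz_ne_zero : vz ≠ 0 := by
  simp [vz, toK6]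

theorem vx_add_iC_mul_vy_ne_zero : vx + iC * vy ≠ 0 := by
  simp only [vx, vy, iC, cC, ← map_mul, ← map_add]
  refine (map_ne_zero_iff toK6 (IsFractionRing.injective _ _)).2 fun h => ?_
  simpa using congrArg (eval (Pi.single 0 1)) h

theorem poisson_eq_hamiltonianDerivation {Pd : Fin 6 → K6 → K6}
    (hPd : ∀ j, IsPDeriv j (Pd j)) (f g : K6) :
    poisson Pd f g = hamiltonianDerivation (fun j => (hPd j).toDerivation) f g := by
  simp [hamiltonianDerivation, poisson]

theorem isFlow_HV {Pd : Fin 6 → K6 → K6} (hPd : ∀ j, IsPDeriv j (Pd j)) (α β γ δ : ℂ) :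
    IsFlow (hamiltonianDerivation (fun j => (hPd j).toDerivation) (HV α β γ δ))
      (cC α) (cC β) (cC γ) (cC δ) (vx + iC * vy) (vx - iC * vy) vz
      (vpx + iC * vpy) (vpx - iC * vpy) vpz := by
  refine isFlow_hamiltonianDerivation _ _ _ _ _ _ _ _ _ _ _ _ iC_sq
    vx_add_iC_mul_vy_ne_zero vz_ne_zero (fun j => ?_) fun j k => ?_
  · exact ⟨(hPd j).map_cC _, (hPd j).map_cC _, (hPd j).map_cC _, (hPd j).map_cC _,
      (hPd j).map_cC _⟩
  · refine Eq.trans ?_ ((hPd j).map_toK6_X k)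
    fin_cases k <;> rfl

theorem four_mul_A2V (β γ : ℂ) :
    4 * A2V β γ = -((vx - iC * vy) * (vpx + iC * vpy) - (vx + iC * vy) * (vpx - iC * vpy)) ^ 2
      + 2 * (cC γ - 2 * cC β) * ((vx + iC * vy) ^ 2 - (vx - iC * vy) ^ 2) / (vx + iC * vy) ^ 2
      + 2 * cC γ * ((vx + iC * vy) + (vx - iC * vy)) ^ 2 / (vx + iC * vy) ^ 2 := by
  unfold A2V Jz
  linear_combination 4 * (vx * vpy - vy * vpx) ^ 2 * iC_sq

theorem four_mul_B1V (β γ δ : ℂ) :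
    4 * B1V β γ δ =
      4 * (vz * (vpx + iC * vpy) - (vx + iC * vy) * vpz)
          * (vz * (vpx - iC * vpy) - (vx - iC * vy) * vpz)
        - ((vx - iC * vy) * (vpx + iC * vpy) - (vx + iC * vy) * (vpx - iC * vpy)) ^ 2
        + 4 * (vz ^ 2 * (cC β * (vz ^ 2 * (vx - iC * vy)
              - ((vx + iC * vy) ^ 2 - (vx - iC * vy) ^ 2) * (vx + iC * vy))
            + cC γ * (vx + iC * vy)
              * (((vx + iC * vy) + (vx - iC * vy)) * (vx + iC * vy) + vz ^ 2))
          + cC δ * (vx - iC * vy) * (vx + iC * vy) ^ 4) / (vz ^ 2 * (vx + iC * vy) ^ 3) := by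
  unfold B1V Jsq Jx Jy Jz
  linear_combination (4 * (vx * vpy - vy * vpx) ^ 2 + 4 * (vy * vpz - vz * vpy) ^ 2
    + 16 * vz ^ 2 * cC β * vx * vy ^ 2 / (vz ^ 2 * (vx + iC * vy) ^ 3)) * iC_sq

theorem Jy_sub_iC_mul_Jx : Jy - iC * Jx = vz * (vpx + iC * vpy) - (vx + iC * vy) * vpz := by
  unfold Jx Jy
  ring

theorem derivation_eq_zero_of_four_mul {D : Derivation ℂ K6 K6} {f : K6} (h : D (4 * f) = 0) :
    D f = 0 := by
  simpa [Derivation.map_ofNat] using h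

theorem kkm_VII_involution (α β γ δ : ℂ) (Pd : Fin 6 → K6 → K6)
    (hPd : ∀ j, IsPDeriv j (Pd j))
    (H A1 A2 B1 B2 F : K6)
    (hH : H = HV α β γ δ) (hA1 : A1 = A1V α δ) (hA2 : A2 = A2V β γ)
    (hB1 : B1 = B1V β γ δ) (hB2 : B2 = B2V α β) (hF : F = FV β δ) :
    poisson Pd H A1 = 0 ∧ poisson Pd H A2 = 0 ∧ poisson Pd H B1 = 0 ∧
      poisson Pd H B2 = 0 ∧ poisson Pd H F = 0 := by
  subst hH hA1 hA2 hB1 hB2 hF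
  have h := isFlow_HV hPd α β γ δ
  have hs := vx_add_iC_mul_vy_ne_zero
  have hz := vz_ne_zero
  simp only [poisson_eq_hamiltonianDerivation hPd]
  refine ⟨h.map_separated hz, derivation_eq_zero_of_four_mul ?_,
    derivation_eq_zero_of_four_mul ?_, h.map_null_momentum hs, ?_⟩
  · rw [four_mul_A2V]
    exact h.map_planar_angular hs
  · rw [four_mul_B1V]
    exact h.map_angular hs hz
  · rw [FV, Jy_sub_iC_mul_Jx]
    exact h.map_null_angular hs hz
end
end

section
/- For the KKM potential V_II, the brackets C₁ = {A₁,B₁}, C₂ = {A₂,B₂}, D = {B₁,B₂}, M = {F,A₂} satisfy the linear dependence relation (B₂+F)C₁ + (−A₂+B₁+H+2δ)C₂ + (A₁+A₂−B₁−H)D + (A₁+2α)M = 0. -/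
noncomputable section

open MvPolynomial

namespace IsPDeriv

variable {j : Fin 6} {D : K6 → K6}

theorem map_add (h : IsPDeriv j D) (f g : K6) : D (f + g) = D f + D g :=
  h.1 f g

theorem map_mul (h : IsPDeriv j D) (f g : K6) : D (f * g) = D f * g + f * D g :=
  h.2.1 f g

theorem map_sub (h : IsPDeriv j D) (f g : K6) : D (f - g) = D f - D g := by
  rw [eq_sub_iff_add_eq, ← h.map_add, sub_add_cancel]

theorem map_neg (h : IsPDeriv j D) (f : K6) : D (-f) = -D f := by
  have h0 := h.map_sub 0 0
  have hf := h.map_sub 0 f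
  rw [sub_self, sub_self] at h0
  rwa [zero_sub, h0, zero_sub] at hf

theorem map_one (h : IsPDeriv j D) : D 1 = 0 := by
  have h1 := h.map_mul 1 1
  rwa [mul_one, mul_one, one_mul, left_eq_add] at h1

theorem map_four (h : IsPDeriv j D) : D 4 = 0 := by
  have h4 : (4 : K6) = 1 + 1 + 1 + 1 := by norm_num
  rw [h4]
  simp only [h.map_add, h.map_one, add_zero]

theorem map_X (h : IsPDeriv j D) (k : Fin 6) : D (toK6 (X k)) = if j = k then 1 else 0 := by
  rw [h.2.2]
  obtain rfl | hjk := eq_or_ne j k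
  · rw [pderiv_X_self, _root_.map_one, if_pos rfl]
  · rw [pderiv_X_of_ne hjk.symm, map_zero, if_neg hjk]

theorem map_pow (h : IsPDeriv j D) (f : K6) (n : ℕ) : D (f ^ n) = n * f ^ (n - 1) * D f := by
  induction n with
  | zero => rw [pow_zero, h.map_one, Nat.cast_zero, zero_mul, zero_mul]
  | succ n ih =>
    rw [pow_succ, h.map_mul, ih]
    cases n with
    | zero => simp only [Nat.cast_zero]; ring
    | succ n => simp only [Nat.add_sub_cancel]; push_cast; ring

theorem map_div (h : IsPDeriv j D) (f g : K6) (hg : g ≠ 0) : D (f / g) = D f / g - f * D g / g ^ 2 := by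
  have hfg := h.map_mul (f / g) g
  rw [div_mul_cancel₀ f hg] at hfg
  rw [hfg]
  field_simp
  ring

end IsPDeriv

theorem toK6_injective : Function.Injective toK6 :=
  IsFractionRing.injective _ _

/-- The null coordinate `u = x + iy`. -/
def cu : K6 := vx + iC * vy
/-- The null coordinate `v = x - iy`. -/
def cv : K6 := vx - iC * vy
/-- The null momentum `P = p_x + i p_y`. -/
def cP : K6 := vpx + iC * vpy
/-- The null momentum `Q = p_x - i p_y`. -/
def cQ : K6 := vpx - iC * vpy

theorem cu_ne_zero : cu ≠ 0 := by
  have h : cu = toK6 (X 0 + C Complex.I * X 1) := by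
    rw [map_add, map_mul]; rfl
  rw [h]
  refine (map_ne_zero_iff _ toK6_injective).2 fun h0 => ?_
  simpa using congrArg (eval ![1, 0, 0, 0, 0, 0]) h0

/-- `HasGrad Pd f fu fv fz fP fQ fr` says that `f` has the given partial derivatives with respect
to the coordinates `u, v, z` and the momenta `P, Q, p_z`. -/
def HasGrad (Pd : Fin 6 → K6 → K6) (f fu fv fz fP fQ fr : K6) : Prop :=
  ∀ j, Pd j f = fu * Pd j cu + fv * Pd j cv + fz * Pd j vz
    + fP * Pd j cP + fQ * Pd j cQ + fr * Pd j vpz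

theorem poisson_eq_of_hasGrad {Pd : Fin 6 → K6 → K6} (hPd : ∀ j, IsPDeriv j (Pd j))
    {f fu fv fz fP fQ fr g gu gv gz gP gQ gr : K6}
    (hf : HasGrad Pd f fu fv fz fP fQ fr) (hg : HasGrad Pd g gu gv gz gP gQ gr) :
    poisson Pd f g = 2 * (fu * gQ + fv * gP - fP * gv - fQ * gu) + (fz * gr - fr * gz) := by
  have hi : ∀ j, Pd j iC = 0 := fun j => (hPd j).map_cC _
  have hadd : ∀ j a b, Pd j (a + b) = Pd j a + Pd j b := fun j => (hPd j).1
  have hmul : ∀ j a b, Pd j (a * b) = Pd j a * b + a * Pd j b := fun j => (hPd j).2.1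
  have hsub : ∀ j a b, Pd j (a - b) = Pd j a - Pd j b := fun j => (hPd j).map_sub
  have hX : ∀ j k, Pd j (toK6 (X k)) = if j = k then 1 else 0 := fun j => (hPd j).map_X
  simp only [poisson, hf _, hg _, cu, cv, cP, cQ, hadd, hsub, hmul, hi, vx, vy, vz, vpx, vpy, vpz,
    hX, Fin.reduceEq, if_true, if_false]
  linear_combination (fu * gP - fu * gQ - fv * gP + fv * gQ
    - fP * gu + fP * gv + fQ * gu - fQ * gv) * iC_sq

section Coordinates

variable (α β γ δ : ℂ)

theorem HV_eq : HV α β γ δ = cP * cQ + vpz ^ 2 + cC α * (cu * cv + vz ^ 2)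
    + cC β * cv / cu ^ 3 + cC γ / cu ^ 2 + cC δ / vz ^ 2 := by
  rw [HV, ← cu, ← cv]
  simp only [cP, cQ, cu, cv]
  linear_combination (vpy ^ 2 + cC α * vy ^ 2) * iC_sq

theorem A2V_eq : A2V β γ = -(cv * cP - cu * cQ) ^ 2 / 4
    + cC γ * (1 + cv / cu) - cC β * (1 - cv ^ 2 / cu ^ 2) := by
  have hJ : Jz ^ 2 = -(cv * cP - cu * cQ) ^ 2 / 4 := by
    simp only [Jz, cP, cQ, cu, cv]
    linear_combination (vx * vpy - vy * vpx) ^ 2 * iC_sq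
  have hx : vx = (cu + cv) / 2 := by simp only [cu, cv]; ring
  have hy : iC * vy = (cu - cv) / 2 := by simp only [cu, cv]; ring
  have h : 2 * iC * vx * vy = (cu ^ 2 - cv ^ 2) / 2 := by
    linear_combination 2 * vx * hy + (cu - cv) * hx
  have := cu_ne_zero
  rw [A2V, ← cu, h, hJ, hx]
  field_simp
  ring

theorem B1V_eq : B1V β γ δ =
    -(cv * cP - cu * cQ) ^ 2 / 4 + (vz * cP - cu * vpz) * (vz * cQ - cv * vpz)
    + cC γ * (1 + cv / cu + vz ^ 2 / cu ^ 2)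
    + cC β * (cv ^ 2 / cu ^ 2 + vz ^ 2 * cv / cu ^ 3 - 1) + cC δ * cu * cv / vz ^ 2 := by
  have hJ : Jsq = -(cv * cP - cu * cQ) ^ 2 / 4 + (vz * cP - cu * vpz) * (vz * cQ - cv * vpz) := by
    simp only [Jsq, Jx, Jy, Jz, cP, cQ, cu, cv]
    linear_combination ((vx * vpy - vy * vpx) ^ 2 + (vy * vpz - vz * vpy) ^ 2) * iC_sq
  have hx : 2 * vx = cu + cv := by simp only [cu, cv]; ring
  have h : 4 * vx * vy * (vy - iC * vx) = -(cu ^ 2 - cv ^ 2) * cu := by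
    simp only [cu, cv]
    linear_combination (4 * vx * vy ^ 2) * iC_sq
  have := cu_ne_zero
  have := vz_ne_zero
  rw [B1V, ← cu, ← cv, h, hJ, hx]
  field_simp
  ring

theorem FV_eq : FV β δ = (vz * cP - cu * vpz) ^ 2
    + cC δ * cu ^ 2 / vz ^ 2 - cC β * vz ^ 2 / cu ^ 2 := by
  have hJ : Jy - iC * Jx = vz * cP - cu * vpz := by
    simp only [Jy, Jx, cP, cu]
    ring
  have := cu_ne_zero
  have := vz_ne_zero
  rw [FV, hJ, show vx + iC * vy = cu from rfl]
  field_simp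
  ring

end Coordinates

section Gradients

variable {Pd : Fin 6 → K6 → K6} (α β γ δ : ℂ)

theorem hasGrad_A1V (hPd : ∀ j, IsPDeriv j (Pd j)) : HasGrad Pd (A1V α δ)
    0 0 (2 * cC α * vz - 2 * cC δ / vz ^ 3) 0 0 (2 * vpz) := by
  intro j
  have hz := vz_ne_zero
  have h := hPd j
  rw [A1V]
  simp only [h.map_add, h.map_mul, h.map_pow, h.map_cC, h.map_div _ _ (pow_ne_zero 2 hz)]
  push_cast
  field_simp
  ring

theorem hasGrad_A2V (hPd : ∀ j, IsPDeriv j (Pd j)) : HasGrad Pd (A2V β γ)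
    ((cv * cP - cu * cQ) * cQ / 2 - cC γ * cv / cu ^ 2 - 2 * cC β * cv ^ 2 / cu ^ 3)
    (-(cv * cP - cu * cQ) * cP / 2 + cC γ / cu + 2 * cC β * cv / cu ^ 2)
    0 (-(cv * cP - cu * cQ) * cv / 2) ((cv * cP - cu * cQ) * cu / 2) 0 := by
  intro j
  have hu := cu_ne_zero
  have h4 : (4 : K6) ≠ 0 := by norm_num
  have h := hPd j
  rw [A2V_eq]
  simp only [h.map_add, h.map_sub, h.map_neg, h.map_mul, h.map_pow, h.map_cC, h.map_one,
    h.map_four, h.map_div _ _ h4, h.map_div _ _ hu,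
    h.map_div _ _ (pow_ne_zero 2 hu)]
  push_cast
  field_simp
  ring

theorem hasGrad_B1V (hPd : ∀ j, IsPDeriv j (Pd j)) : HasGrad Pd (B1V β γ δ)
    ((cv * cP - cu * cQ) * cQ / 2 - vpz * (vz * cQ - cv * vpz)
      - cC γ * (cv / cu ^ 2 + 2 * vz ^ 2 / cu ^ 3)
      - cC β * (2 * cv ^ 2 / cu ^ 3 + 3 * vz ^ 2 * cv / cu ^ 4) + cC δ * cv / vz ^ 2)
    (-(cv * cP - cu * cQ) * cP / 2 - vpz * (vz * cP - cu * vpz)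
      + cC γ / cu + cC β * (2 * cv / cu ^ 2 + vz ^ 2 / cu ^ 3) + cC δ * cu / vz ^ 2)
    (cP * (vz * cQ - cv * vpz) + cQ * (vz * cP - cu * vpz)
      + 2 * cC γ * vz / cu ^ 2 + 2 * cC β * vz * cv / cu ^ 3 - 2 * cC δ * cu * cv / vz ^ 3)
    (-(cv * cP - cu * cQ) * cv / 2 + vz * (vz * cQ - cv * vpz))
    ((cv * cP - cu * cQ) * cu / 2 + vz * (vz * cP - cu * vpz))
    (-cu * (vz * cQ - cv * vpz) - cv * (vz * cP - cu * vpz)) := by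
  intro j
  have hu := cu_ne_zero
  have hz := vz_ne_zero
  have h4 : (4 : K6) ≠ 0 := by norm_num
  have h := hPd j
  rw [B1V_eq]
  simp only [h.map_add, h.map_sub, h.map_neg, h.map_mul, h.map_pow, h.map_cC, h.map_one,
    h.map_four, h.map_div _ _ h4, h.map_div _ _ hu,
    h.map_div _ _ (pow_ne_zero 2 hu), h.map_div _ _ (pow_ne_zero 3 hu),
    h.map_div _ _ (pow_ne_zero 2 hz)]
  push_cast
  field_simp
  ring

theorem hasGrad_B2V (hPd : ∀ j, IsPDeriv j (Pd j)) : HasGrad Pd (B2V α β)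
    (2 * cC α * cu + 2 * cC β / cu ^ 3) 0 0 (2 * cP) 0 0 := by
  intro j
  have hu := cu_ne_zero
  have h := hPd j
  rw [B2V, ← cu, ← cP]
  simp only [h.map_add, h.map_sub, h.map_mul, h.map_pow, h.map_cC,
    h.map_div _ _ (pow_ne_zero 2 hu)]
  push_cast
  field_simp
  ring

theorem hasGrad_FV (hPd : ∀ j, IsPDeriv j (Pd j)) : HasGrad Pd (FV β δ)
    (-2 * vpz * (vz * cP - cu * vpz) + 2 * cC δ * cu / vz ^ 2 + 2 * cC β * vz ^ 2 / cu ^ 3)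
    0 (2 * cP * (vz * cP - cu * vpz) - 2 * cC δ * cu ^ 2 / vz ^ 3 - 2 * cC β * vz / cu ^ 2)
    (2 * vz * (vz * cP - cu * vpz)) 0 (-2 * cu * (vz * cP - cu * vpz)) := by
  intro j
  have hu := cu_ne_zero
  have hz := vz_ne_zero
  have h := hPd j
  rw [FV_eq]
  simp only [h.map_add, h.map_sub, h.map_mul, h.map_pow, h.map_cC,
    h.map_div _ _ (pow_ne_zero 2 hu), h.map_div _ _ (pow_ne_zero 2 hz)]
  push_cast
  field_simp
  ring

end Gradients

theorem kkm_VII_linear_relation (α β γ δ : ℂ) (Pd : Fin 6 → K6 → K6)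
    (hPd : ∀ j, IsPDeriv j (Pd j))
    (H A1 A2 B1 B2 F : K6)
    (hH : H = HV α β γ δ) (hA1 : A1 = A1V α δ) (hA2 : A2 = A2V β γ)
    (hB1 : B1 = B1V β γ δ) (hB2 : B2 = B2V α β) (hF : F = FV β δ)
    (C1 C2 Dv M : K6) (hC1 : C1 = poisson Pd A1 B1) (hC2 : C2 = poisson Pd A2 B2)
    (hDv : Dv = poisson Pd B1 B2) (hM : M = poisson Pd F A2) :
    (B2 + F) * C1 + (-A2 + B1 + H + 2 * cC δ) * C2
      + (A1 + A2 - B1 - H) * Dv + (A1 + 2 * cC α) * M = 0 := by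
  have hu := cu_ne_zero
  have hz := vz_ne_zero
  have hB := hasGrad_B1V β γ δ hPd
  have hA := hasGrad_A2V β γ hPd
  have hE := hasGrad_B2V α β hPd
  rw [hC1, hC2, hDv, hM, hA1, hA2, hB1, hB2, hF, hH,
    poisson_eq_of_hasGrad hPd (hasGrad_A1V α δ hPd) hB, poisson_eq_of_hasGrad hPd hA hE,
    poisson_eq_of_hasGrad hPd hB hE, poisson_eq_of_hasGrad hPd (hasGrad_FV β δ hPd) hA,
    A1V, A2V_eq, B1V_eq, B2V, FV_eq, HV_eq, ← cu, ← cP]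
  generalize cu = u at *
  generalize cv = v at *
  generalize vz = z at *
  generalize cP = P at *
  generalize cQ = Q at *
  generalize vpz = r at *
  generalize cC α = a at *
  generalize cC β = b at *
  generalize cC γ = c at *
  generalize cC δ = d at *
  field_simp
  ring
end
end
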